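/- Let P ∈ ℂ[x₁,…,xₙ], and suppose there exists a sequence (A_k)_{k≥1} of complex n×n matrices with A_kᵀA_k = I for all k, such that the polynomials P∘A_k (obtained by substituting xᵢ ↦ Σⱼ (A_k)_{ij} xⱼ into P) converge coefficientwise to the zero polynomial as k → ∞. Then E(Pᵐ) = 0 for every integer m ≥ 1, where E denotes the Gaussian expectation with respect to γₙ. -/

import Mathlib

open MeasureTheory ProbabilityTheory Filter

/-- The Gaussian expectation of a complex polynomial in the variables indexed by `σ`,
with respect to the standard Gaussian measure (product of `N(0,1)`'s). -/
noncomputable def gaussExp {σ : Type*} [Fintype σ] (P : MvPolynomial σ ℂ) : ℂ :=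
  ∫ x : σ → ℝ, MvPolynomial.eval (fun i => (x i : ℂ)) P
    ∂(Measure.pi fun _ : σ => gaussianReal 0 1)

/-- Integration by parts for the moments of the standard Gaussian on the line. -/
lemma integral_pow_succ_gaussianReal (k : ℕ) :
    ∫ x, (x : ℂ) ^ (k + 1) ∂gaussianReal 0 1 =
      k * ∫ x, (x : ℂ) ^ (k - 1) ∂gaussianReal 0 1 := by
  have hintegrable (j : ℕ) : Integrable (fun x : ℝ => x ^ j * gaussianPDFReal 0 1 x) := by
    have h := (integrable_rpow_mul_exp_neg_mul_sq (b := 1 / 2) (by norm_num) (s := j)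
      (by linarith [j.cast_nonneg (α := ℝ)])).const_mul (√(2 * Real.pi))⁻¹
    refine h.congr (ae_of_all _ fun x => ?_)
    simp only [gaussianPDFReal, Real.rpow_natCast, NNReal.coe_one, mul_one, sub_zero]
    rw [show -x ^ 2 / 2 = -(1 / 2) * x ^ 2 by ring]
    ring
  have hderiv (x : ℝ) :
      HasDerivAt (gaussianPDFReal 0 1) (-(x * gaussianPDFReal 0 1 x)) x := by
    have h : HasDerivAt (fun y : ℝ => -(y - 0) ^ 2 / (2 * ((1 : NNReal) : ℝ))) (-x) x := by
      have := (((hasDerivAt_id x).sub_const 0).pow 2).neg.div_const (2 * ((1 : NNReal) : ℝ))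
      refine this.congr_deriv ?_
      simp
      ring
    refine (h.exp.const_mul (√(2 * Real.pi * ((1 : NNReal) : ℝ)))⁻¹).congr_deriv ?_
    simp only [gaussianPDFReal]
    ring
  have hparts := integral_mul_deriv_eq_deriv_mul_of_integrable
    (u := fun x : ℝ => x ^ k) (v := gaussianPDFReal 0 1)
    (fun x _ => hasDerivAt_pow k x) (fun x _ => hderiv x)
    ((hintegrable (k + 1)).neg.congr (ae_of_all _ fun x => by simp; ring))
    (((hintegrable (k - 1)).const_mul (k : ℝ)).congr (ae_of_all _ fun x => by simp; ring))
    (hintegrable k)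
  have hreal : ∫ x, x ^ (k + 1) ∂gaussianReal 0 1 =
      k * ∫ x, x ^ (k - 1) ∂gaussianReal 0 1 := by
    rw [integral_gaussianReal_eq_integral_smul one_ne_zero,
      integral_gaussianReal_eq_integral_smul one_ne_zero, ← integral_const_mul,
      ← neg_inj, ← integral_neg]
    refine (integral_congr_ae <| ae_of_all _ fun x => ?_).trans
      (hparts.trans <| congrArg Neg.neg <| integral_congr_ae <| ae_of_all _ fun x => ?_)
    all_goals
      simp only [smul_eq_mul]
      ring
  exact_mod_cast congrArg ((↑) : ℝ → ℂ) hreal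

lemma integrable_pow_gaussianReal (k : ℕ) :
    Integrable (fun x : ℝ => (x : ℂ) ^ k) (gaussianReal 0 1) := by
  have h : Integrable (fun x : ℝ => x ^ k) (gaussianReal 0 1) :=
    integrable_pow_of_mem_interior_integrableExpSet (X := id) (by simp) k
  simpa using h.ofReal (𝕜 := ℂ)

section Stein

variable {σ : Type*} [Fintype σ]

lemma integrable_eval_gaussian (P : MvPolynomial σ ℂ) :
    Integrable (fun x : σ → ℝ => MvPolynomial.eval (fun i => (x i : ℂ)) P)
      (Measure.pi fun _ : σ => gaussianReal 0 1) := by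
  simp only [MvPolynomial.eval_eq']
  exact integrable_finsetSum _ fun d _ =>
    (Integrable.fintype_prod fun i => integrable_pow_gaussianReal (d i)).const_mul _

/-- `gaussExp` as a linear functional. -/
noncomputable def gaussExpLinear (σ : Type*) [Fintype σ] : MvPolynomial σ ℂ →ₗ[ℂ] ℂ where
  toFun := gaussExp
  map_add' P Q := by
    simp only [gaussExp, map_add]
    exact integral_add (integrable_eval_gaussian P) (integrable_eval_gaussian Q)
  map_smul' c P := by
    simp only [gaussExp, MvPolynomial.smul_eval, RingHom.id_apply, smul_eq_mul]
    exact integral_const_mul _ _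

lemma gaussExpLinear_apply (P : MvPolynomial σ ℂ) : gaussExpLinear σ P = gaussExp P := rfl

lemma gaussExp_monomial (s : σ →₀ ℕ) (c : ℂ) :
    gaussExp (MvPolynomial.monomial s c) =
      c * ∏ i, ∫ x, (x : ℂ) ^ s i ∂gaussianReal 0 1 := by
  rw [← integral_fintype_prod_eq_prod (fun (i : σ) (x : ℝ) => (x : ℂ) ^ s i),
    ← integral_const_mul]
  simp [gaussExp, MvPolynomial.eval_monomial, Finsupp.prod_fintype]

/-- **Stein's identity** for polynomials. -/
lemma gaussExpLinear_X_mul (i : σ) (P : MvPolynomial σ ℂ) :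
    gaussExpLinear σ (MvPolynomial.X i * P) = gaussExpLinear σ (MvPolynomial.pderiv i P) := by
  classical
  induction P using MvPolynomial.induction_on' with
  | add P Q hP hQ => rw [mul_add, map_add, map_add, map_add, hP, hQ]
  | monomial s c =>
    rw [MvPolynomial.pderiv_monomial, MvPolynomial.X, MvPolynomial.monomial_mul, one_mul,
      gaussExpLinear_apply, gaussExpLinear_apply, gaussExp_monomial, gaussExp_monomial,
      ← Finset.mul_prod_erase _ _ (Finset.mem_univ i),
      ← Finset.mul_prod_erase Finset.univ
        (fun j => ∫ x, (x : ℂ) ^ (s - Finsupp.single i 1 : σ →₀ ℕ) j ∂gaussianReal 0 1)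
        (Finset.mem_univ i)]
    have h : ∀ j ∈ Finset.univ.erase i,
        ∫ x, (x : ℂ) ^ (Finsupp.single i 1 + s : σ →₀ ℕ) j ∂gaussianReal 0 1 =
        ∫ x, (x : ℂ) ^ (s - Finsupp.single i 1 : σ →₀ ℕ) j ∂gaussianReal 0 1 := by
      intro j hj
      simp [Finsupp.single_eq_of_ne (Finset.ne_of_mem_erase hj)]
    rw [Finset.prod_congr rfl h]
    simp only [Finsupp.add_apply, Finsupp.tsub_apply, Finsupp.single_eq_same]
    rw [add_comm 1, integral_pow_succ_gaussianReal]
    ring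

/-- Stein's identity determines a linear functional up to its value at `1`. -/
lemma eq_of_X_mul_eq_pderiv {R M σ : Type*} [CommRing R] [AddCommGroup M] [Module R M]
    (L₁ L₂ : MvPolynomial σ R →ₗ[R] M) (h1 : L₁ 1 = L₂ 1)
    (hL₁ : ∀ i P, L₁ (MvPolynomial.X i * P) = L₁ (MvPolynomial.pderiv i P))
    (hL₂ : ∀ i P, L₂ (MvPolynomial.X i * P) = L₂ (MvPolynomial.pderiv i P)) :
    L₁ = L₂ := by
  have key : ∀ (d : ℕ) (s : σ →₀ ℕ) (c : R), s.degree = d →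
      L₁ (MvPolynomial.monomial s c) = L₂ (MvPolynomial.monomial s c) := by
    intro d
    induction d using Nat.strong_induction_on with
    | _ d ih =>
      intro s c hs
      by_cases h0 : s = 0
      · rw [h0, show MvPolynomial.monomial 0 c = c • (1 : MvPolynomial σ R) by
          simp [MvPolynomial.smul_eq_C_mul], map_smul, map_smul, h1]
      · obtain ⟨i, hi⟩ := Finsupp.ne_iff.mp h0
        obtain ⟨t, rfl⟩ : ∃ t, s = Finsupp.single i 1 + t :=
          exists_add_of_le (by simpa [Nat.one_le_iff_ne_zero] using hi)
        have hX : MvPolynomial.monomial (Finsupp.single i 1 + t) c =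
            MvPolynomial.X i * MvPolynomial.monomial t c := by
          rw [MvPolynomial.X, MvPolynomial.monomial_mul, one_mul]
        rw [hX, hL₁, hL₂, MvPolynomial.pderiv_monomial]
        refine ih _ ?_ _ _ rfl
        have := Finsupp.degree_mono (tsub_le_self : t - Finsupp.single i 1 ≤ t)
        simp only [map_add, Finsupp.degree_single] at hs
        omega
  refine LinearMap.ext fun P => ?_
  induction P using MvPolynomial.induction_on' with
  | monomial s c => exact key _ s c rfl
  | add P Q hP hQ => rw [map_add, map_add, hP, hQ]

end Stein

section LinearSubstitution

variable {σ R : Type*} [Fintype σ] [CommRing R]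

/-- The substitution `xᵢ ↦ ∑ⱼ Aᵢⱼ xⱼ`. -/
noncomputable def linearSubst (A : Matrix σ σ R) : MvPolynomial σ R →ₐ[R] MvPolynomial σ R :=
  MvPolynomial.aeval fun i => ∑ j, MvPolynomial.C (A i j) * MvPolynomial.X j

lemma linearSubst_X (A : Matrix σ σ R) (i : σ) :
    linearSubst A (MvPolynomial.X i) = ∑ j, MvPolynomial.C (A i j) * MvPolynomial.X j :=
  MvPolynomial.aeval_X _ _

lemma pderiv_linearSubst (A : Matrix σ σ R) (j : σ) (P : MvPolynomial σ R) :
    MvPolynomial.pderiv j (linearSubst A P) =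
      ∑ k, MvPolynomial.C (A k j) * linearSubst A (MvPolynomial.pderiv k P) := by
  classical
  induction P using MvPolynomial.induction_on with
  | C a => simp [linearSubst]
  | add P Q hP hQ => simp [hP, hQ, mul_add, Finset.sum_add_distrib]
  | mul_X P i hP =>
    have hX : MvPolynomial.pderiv j (linearSubst A (MvPolynomial.X i)) =
        MvPolynomial.C (A i j) := by
      simp [linearSubst_X, MvPolynomial.pderiv_X, Pi.single_apply]
    simp only [map_mul, Derivation.leibniz, hP, hX, smul_eq_mul, map_add,
      MvPolynomial.pderiv_X, Pi.single_apply, mul_add, Finset.sum_add_distrib, Finset.mul_sum]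
    congr 1
    · simp [apply_ite (linearSubst A), mul_comm]
    · exact Finset.sum_congr rfl fun k _ => by ring

lemma totalDegree_linearSubst_le (A : Matrix σ σ R) (P : MvPolynomial σ R) :
    (linearSubst A P).totalDegree ≤ P.totalDegree := by
  have hlin (i : σ) : (∑ j, MvPolynomial.C (A i j) * MvPolynomial.X j :
      MvPolynomial σ R).totalDegree ≤ 1 :=
    MvPolynomial.totalDegree_finsetSum_le fun j _ =>
      (MvPolynomial.totalDegree_mul _ _).trans <| by
        simpa using (MvPolynomial.isHomogeneous_X R j).totalDegree_le
  rw [linearSubst, MvPolynomial.aeval_def, MvPolynomial.eval₂_eq']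
  refine MvPolynomial.totalDegree_finsetSum_le fun s hs => ?_
  refine le_trans ?_ (MvPolynomial.le_totalDegree hs)
  refine (MvPolynomial.totalDegree_mul _ _).trans ?_
  rw [MvPolynomial.algebraMap_eq, MvPolynomial.totalDegree_C, zero_add,
    Finsupp.sum_fintype _ _ fun _ => rfl]
  refine (MvPolynomial.totalDegree_finsetProd _ _).trans (Finset.sum_le_sum fun i _ => ?_)
  exact (MvPolynomial.totalDegree_pow _ _).trans (mul_le_of_le_one_right (Nat.zero_le _) (hlin i))

/-- The Gaussian expectation is invariant under complex orthogonal substitutions. -/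
lemma gaussExp_linearSubst [DecidableEq σ] (A : Matrix σ σ ℂ) (hA : A.transpose * A = 1)
    (P : MvPolynomial σ ℂ) : gaussExp (linearSubst A P) = gaussExp P := by
  have hA' : A * A.transpose = 1 := mul_eq_one_comm.mp hA
  refine LinearMap.congr_fun (eq_of_X_mul_eq_pderiv
    (gaussExpLinear σ ∘ₗ (linearSubst A).toLinearMap) (gaussExpLinear σ) (by simp)
    (fun i Q => ?_) gaussExpLinear_X_mul) P
  have hrow (k : σ) : ∑ j, A i j * A k j = if i = k then 1 else 0 := by
    simpa [Matrix.mul_apply, Matrix.one_apply] using congrFun (congrFun hA' i) k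
  simp only [LinearMap.comp_apply, AlgHom.toLinearMap_apply, map_mul, linearSubst_X,
    Finset.sum_mul, map_sum, smul_mul_assoc, ← MvPolynomial.smul_eq_C_mul, map_smul,
    gaussExpLinear_X_mul, pderiv_linearSubst, Finset.smul_sum, smul_smul]
  rw [Finset.sum_comm]
  simp [← Finset.sum_mul, hrow]

end LinearSubstitution

section Limits

variable {σ ι : Type*} {l : Filter ι}

lemma tendsto_coeff_pow_zero {Q : ι → MvPolynomial σ ℂ}
    (hQ : ∀ α, Tendsto (fun k => (Q k).coeff α) l (nhds 0)) {m : ℕ} (hm : 1 ≤ m) (α : σ →₀ ℕ) :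
    Tendsto (fun k => (Q k ^ m).coeff α) l (nhds 0) := by
  classical
  induction m, hm using Nat.le_induction generalizing α with
  | base => simpa using hQ α
  | succ m _ ih =>
    simp only [pow_succ, MvPolynomial.coeff_mul]
    simpa using tendsto_finsetSum (Finset.HasAntidiagonal.antidiagonal α)
      fun p _ => (ih p.1).mul (hQ p.2)

lemma tendsto_gaussExp_zero [Fintype σ] {Q : ι → MvPolynomial σ ℂ} {d : ℕ}
    (hd : ∀ k, (Q k).totalDegree ≤ d)
    (hQ : ∀ α, Tendsto (fun k => (Q k).coeff α) l (nhds 0)) :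
    Tendsto (fun k => gaussExp (Q k)) l (nhds 0) := by
  have hfin : {α : σ →₀ ℕ | α.degree ≤ d}.Finite := Finsupp.finite_of_degree_le d
  have hsum (k : ι) : gaussExp (Q k) =
      ∑ α ∈ hfin.toFinset, (Q k).coeff α * gaussExp (MvPolynomial.monomial α 1) := by
    have hsub : (Q k).support ⊆ hfin.toFinset := fun α hα => by
      rw [Set.Finite.mem_toFinset]
      exact (MvPolynomial.le_totalDegree hα).trans (hd k)
    rw [← Finset.sum_subset hsub fun α _ hα => by
      rw [MvPolynomial.notMem_support_iff.mp hα, zero_mul]]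
    conv_lhs => rw [← gaussExpLinear_apply, (Q k).as_sum, map_sum]
    exact Finset.sum_congr rfl fun α _ => by
      rw [gaussExpLinear_apply, gaussExp_monomial, gaussExp_monomial, one_mul]
  simp only [hsum]
  simpa using tendsto_finsetSum hfin.toFinset fun α _ =>
    (hQ α).mul_const (gaussExp (MvPolynomial.monomial α 1))

end Limits

/-- if there is a sequence of complex orthogonal matrices `A_k`
(`A_kᵀ A_k = I`) such that the polynomials `P ∘ A_k` converge coefficientwise to `0`,
then all Gaussian moments `E(P^m)`, `m ≥ 1`, vanish. -/
theorem gaussian_moments_vanish_of_orbit_closure (n : ℕ)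
    (P : MvPolynomial (Fin n) ℂ) (A : ℕ → Matrix (Fin n) (Fin n) ℂ)
    (hA : ∀ k : ℕ, (A k).transpose * A k = 1)
    (hconv : ∀ α : Fin n →₀ ℕ,
      Tendsto
        (fun k => MvPolynomial.coeff α
          (MvPolynomial.aeval
            (fun i => ∑ j : Fin n, MvPolynomial.C (A k i j) * MvPolynomial.X j) P))
        atTop (nhds (0 : ℂ))) :
    ∀ m : ℕ, 1 ≤ m → gaussExp (P ^ m) = 0 := by
  intro m hm
  have hlim : Tendsto (fun k => gaussExp (linearSubst (A k) (P ^ m))) atTop (nhds 0) := by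
    refine tendsto_gaussExp_zero (fun k => totalDegree_linearSubst_le (A k) (P ^ m)) fun α => ?_
    simpa only [map_pow] using tendsto_coeff_pow_zero (Q := fun k => linearSubst (A k) P) hconv hm α
  simp only [gaussExp_linearSubst _ (hA _)] at hlim
  exact tendsto_const_nhds_iff.mp hlim
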